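/- Let p, q be natural numbers with n = p + q odd. If p − q ≡ 5 (mod 8), then the Clifford algebra Cl(p,q) is isomorphic as an ℝ-algebra to the product M_{2^{(n−3)/2}}(ℍ) × M_{2^{(n−3)/2}}(ℍ) of two copies of the quaternionic matrix algebra of size 2^{(n−3)/2} (equivalently, to the algebra of block-diagonal matrices diag(A, B) with A, B ∈ M_{2^{(n−3)/2}}(ℍ)). -/

import Mathlib

open Quaternion Matrix CliffordAlgebra

/-- The quadratic form of signature `(p,q)` on `ℝⁿ`, `n = p + q`. -/
noncomputable def Qpq (p q : ℕ) : QuadraticForm ℝ (Fin (p + q) → ℝ) :=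
  QuadraticMap.weightedSumSquares ℝ (fun i : Fin (p + q) => if (i : ℕ) < p then (1 : ℝ) else -1)

set_option linter.unusedSimpArgs false

/-- A Clifford system: anticommuting generators `e i` of `A` with `(e i)² = s i`. -/
structure CliffSys {ι A : Type} [Ring A] [Algebra ℝ A] (s : ι → ℝ) (e : ι → A) : Prop where
  sq : ∀ i, e i * e i = s i • (1 : A)
  anti : ∀ i j, i ≠ j → e i * e j = -(e j * e i)
  gen : Algebra.adjoin ℝ (Set.range e) = ⊤

theorem CliffSys.reindex {ι κ A : Type} [Ring A] [Algebra ℝ A] {s : ι → ℝ} {e : ι → A}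
    (h : CliffSys s e) (f : κ ≃ ι) {t : κ → ℝ} (ht : ∀ k, t k = s (f k)) :
    CliffSys t (e ∘ f) where
  sq i := by rw [ht]; exact h.sq _
  anti i j hij := h.anti _ _ (f.injective.ne hij)
  gen := by rw [f.surjective.range_comp]; exact h.gen

theorem CliffSys.map {ι A B : Type} [Ring A] [Algebra ℝ A] [Ring B] [Algebra ℝ B]
    {s : ι → ℝ} {e : ι → A}
    (h : CliffSys s e) (f : A ≃ₐ[ℝ] B) : CliffSys s (fun i => f (e i)) where
  sq i := by rw [← map_mul, h.sq]; simp
  anti i j hij := by rw [← map_mul, h.anti i j hij]; simp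
  gen := by
    have : Set.range (fun i => f (e i)) = Set.image (f : A →ₐ[ℝ] B) (Set.range e) := by
      ext; simp
    rw [this, Algebra.adjoin_image, h.gen, Algebra.map_top, AlgHom.range_eq_top]
    exact f.surjective

theorem CliffSys.sum_sq {ι A : Type} [Fintype ι] [Ring A] [Algebra ℝ A] {s : ι → ℝ} {e : ι → A}
    (h : CliffSys s e) (v : ι → ℝ) :
    (∑ i, v i • e i) * (∑ i, v i • e i) = (∑ i, s i * (v i * v i)) • (1 : A) := by
  classical
  have h1 : (∑ i, v i • e i) * (∑ i, v i • e i)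
      = ∑ i, ∑ j, (v i * v j) • (e i * e j) := by
    rw [Finset.sum_mul_sum]
    simp [smul_smul, mul_comm]
  have h2 : (2 : ℝ) • (∑ i, ∑ j, (v i * v j) • (e i * e j))
      = (2 : ℝ) • ((∑ i, s i * (v i * v i)) • (1 : A)) := by
    rw [two_smul]
    conv_lhs => arg 2; rw [Finset.sum_comm]
    rw [← Finset.sum_add_distrib, Finset.sum_smul, Finset.smul_sum]
    refine Finset.sum_congr rfl fun i _ => ?_
    rw [← Finset.sum_add_distrib, Finset.sum_eq_single i]
    · rw [h.sq, smul_smul, ← two_smul ℝ, mul_comm (s i)]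
    · intro j _ hj
      rw [h.anti i j hj.symm, mul_comm (v j)]
      simp
    · simp
  rw [h1]
  exact (smul_right_injective A (two_ne_zero (α := ℝ))) h2

theorem clifford_finrank {n : ℕ} (Q : QuadraticForm ℝ (Fin n → ℝ)) :
    Module.finrank ℝ (CliffordAlgebra Q) = 2 ^ n ∧ Module.Finite ℝ (CliffordAlgebra Q) := by
  let b := ((Pi.basisFun ℝ (Fin n)).ExteriorAlgebra).map (CliffordAlgebra.equivExterior Q).symm
  refine ⟨?_, Module.Finite.of_basis b⟩
  rw [Module.finrank_eq_card_basis b]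
  simp

theorem CliffSys.equiv {n : ℕ} {A : Type} [Ring A] [Algebra ℝ A] [Module.Finite ℝ A]
    {s : Fin n → ℝ} {e : Fin n → A} (h : CliffSys s e) (hA : Module.finrank ℝ A = 2 ^ n) :
    Nonempty (CliffordAlgebra (QuadraticMap.weightedSumSquares ℝ s) ≃ₐ[ℝ] A) := by
  obtain ⟨hr, hf⟩ := clifford_finrank (QuadraticMap.weightedSumSquares ℝ s)
  let f : (Fin n → ℝ) →ₗ[ℝ] A := Fintype.linearCombination ℝ e
  have hfv : ∀ v, f v * f v = algebraMap ℝ A (QuadraticMap.weightedSumSquares ℝ s v) := by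
    intro v
    have := h.sum_sq v
    rw [Algebra.algebraMap_eq_smul_one]
    simpa [f, Fintype.linearCombination_apply, QuadraticMap.weightedSumSquares_apply] using this
  let F := CliffordAlgebra.lift (QuadraticMap.weightedSumSquares ℝ s) ⟨f, hfv⟩
  have hs : Function.Surjective F := by
    rw [← AlgHom.range_eq_top, eq_top_iff, ← h.gen, Algebra.adjoin_le_iff]
    rintro _ ⟨i, rfl⟩
    refine ⟨CliffordAlgebra.ι _ (Pi.single i 1), ?_⟩
    simp [F, f, Fintype.linearCombination_apply_single]
  have hi : Function.Injective F :=
    (LinearMap.injective_iff_surjective_of_finrank_eq_finrank (f := F.toLinearMap)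
      (hr.trans hA.symm)).2 hs
  exact ⟨AlgEquiv.ofBijective F ⟨hi, hs⟩⟩

theorem four_aux {A : Type} [Ring A] [Algebra ℝ A] {c : ℝ} (hc : c * c = 1) {b : Fin 4 → A}
    (sq : ∀ i, b i * b i = c • (1 : A))
    (anti : ∀ i j, i ≠ j → b i * b j = -(b j * b i)) :
    (∀ i, (b 0 * b 1 * b 2 * b 3) * b i = -(b i * (b 0 * b 1 * b 2 * b 3))) ∧
    (b 0 * b 1 * b 2 * b 3) * (b 0 * b 1 * b 2 * b 3) = 1 := by
  have sq' : ∀ i x, b i * (b i * x) = c • x := fun i x => by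
    rw [← mul_assoc, sq]; simp
  have anti' : ∀ i j, i ≠ j → ∀ x, b i * (b j * x) = -(b j * (b i * x)) := fun i j h x => by
    rw [← mul_assoc, anti i j h]; simp [mul_assoc]
  have a10 := anti 1 0 (by decide)
  have a20 := anti 2 0 (by decide)
  have a30 := anti 3 0 (by decide)
  have a21 := anti 2 1 (by decide)
  have a31 := anti 3 1 (by decide)
  have a32 := anti 3 2 (by decide)
  have b10 := anti' 1 0 (by decide)
  have b20 := anti' 2 0 (by decide)
  have b30 := anti' 3 0 (by decide)
  have b21 := anti' 2 1 (by decide)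
  have b31 := anti' 3 1 (by decide)
  have b32 := anti' 3 2 (by decide)
  constructor
  · intro i
    fin_cases i <;>
    simp [mul_assoc, sq, sq', a10, a20, a30, a21, a31, a32, b10, b20, b30, b21, b31, b32]
  · simp [mul_assoc, sq, sq', a10, a20, a30, a21, a31, a32, b10, b20, b30, b21, b31, b32,
      smul_smul, hc]

/-- Flip the sign of four generators. -/
theorem CliffSys.flip {ι A : Type} [Ring A] [Algebra ℝ A] {s : ι → ℝ} {c : ℝ} (hc : c * c = 1)
    {e : ι ⊕ Fin 4 → A} (h : CliffSys (Sum.elim s (fun _ => c)) e) :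
    ∃ e' : ι ⊕ Fin 4 → A, CliffSys (Sum.elim s (fun _ => -c)) e' := by
  let b : Fin 4 → A := fun i => e (Sum.inr i)
  have sq : ∀ i, b i * b i = c • (1 : A) := fun i => h.sq (Sum.inr i)
  have anti : ∀ i j, i ≠ j → b i * b j = -(b j * b i) :=
    fun i j hij => h.anti _ _ (by simpa using hij)
  obtain ⟨hw, hww⟩ := four_aux hc sq anti
  have hx : ∀ i, e (Sum.inl i) * (b 0 * b 1 * b 2 * b 3)
      = (b 0 * b 1 * b 2 * b 3) * e (Sum.inl i) := by
    intro i
    have h1 : ∀ j, e (Sum.inl i) * b j = -(b j * e (Sum.inl i)) :=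
      fun j => h.anti _ _ (by simp)
    have h2 : ∀ j x, e (Sum.inl i) * (b j * x) = -(b j * (e (Sum.inl i) * x)) := fun j x => by
      rw [← mul_assoc, h1]; simp [mul_assoc]
    simp [mul_assoc, h1, h2]
  have hwdef : b 0 * b 1 * b 2 * b 3 = b 0 * b 1 * b 2 * b 3 := rfl
  generalize hW : b 0 * b 1 * b 2 * b 3 = w at hw hww hx
  have hww' : ∀ x, w * (w * x) = x := fun x => by rw [← mul_assoc, hww, one_mul]
  have hw' : ∀ i x, b i * (w * x) = -(w * (b i * x)) := fun i x => by
    rw [← mul_assoc, ← mul_assoc, hw]; simp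
  have hwr : ∀ i, b i * w = -(w * b i) := fun i => by rw [hw]; simp
  have hx' : ∀ i x, e (Sum.inl i) * (w * x) = w * (e (Sum.inl i) * x) := fun i x => by
    rw [← mul_assoc, hx, mul_assoc]
  refine ⟨Sum.elim (fun i => e (Sum.inl i)) (fun i => w * b i), ?_, ?_, ?_⟩
  · rintro (i | i)
    · simpa using h.sq (Sum.inl i)
    · simp [mul_assoc, hw', hww, hww', sq]
  · rintro (i | i) (j | j) hij
    · exact h.anti _ _ hij
    · have := h.anti (Sum.inl i) (Sum.inr j) (by simp)
      simp only [Sum.elim_inl, Sum.elim_inr, hx', mul_assoc]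
      rw [this]; simp [b]
    · have := h.anti (Sum.inr i) (Sum.inl j) (by simp)
      simp only [Sum.elim_inl, Sum.elim_inr, hx', mul_assoc]
      change w * (e (Sum.inr i) * _) = _
      rw [this]; simp [b]
    · have := anti i j (by simpa using hij)
      simp only [Sum.elim_inr, mul_assoc, hw', mul_neg, hww']
      rw [this]
  · set S := Algebra.adjoin ℝ (Set.range (Sum.elim (fun i => e (Sum.inl i)) (fun i => w * b i)))
    have m1 : ∀ i, e (Sum.inl i) ∈ S := fun i => Algebra.subset_adjoin ⟨Sum.inl i, rfl⟩
    have m2 : ∀ i, w * b i ∈ S := fun i => Algebra.subset_adjoin ⟨Sum.inr i, rfl⟩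
    have m3 : w ∈ S := by
      have : (w * b 0) * (w * b 1) * ((w * b 2) * (w * b 3)) = w := by
        simp only [mul_assoc, hw', mul_neg, hww', neg_mul, neg_neg]
        rw [← hW]; simp only [mul_assoc]
      rw [← this]
      exact mul_mem (mul_mem (m2 _) (m2 _)) (mul_mem (m2 _) (m2 _))
    rw [eq_top_iff, ← h.gen, Algebra.adjoin_le_iff]
    rintro _ ⟨i | i, rfl⟩
    · exact m1 i
    · have := mul_mem m3 (m2 i)
      rwa [hww'] at this

/-- Add a hyperbolic pair. -/
theorem CliffSys.hyp {ι A : Type} [Ring A] [Algebra ℝ A] {s : ι → ℝ}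
    {e : ι → A} (h : CliffSys s e) :
    ∃ e' : ι ⊕ (Fin 1 ⊕ Fin 1) → Matrix (Fin 2) (Fin 2) A,
      CliffSys (Sum.elim s (Sum.elim (fun _ => 1) (fun _ => -1))) e' := by
  have hone : (1 : Matrix (Fin 2) (Fin 2) A) = !![1, 0; 0, 1] := Matrix.one_fin_two
  refine ⟨Sum.elim (fun i => !![e i, 0; 0, - e i])
    (Sum.elim (fun _ => !![0, 1; 1, 0]) (fun _ => !![0, 1; -1, 0])), ?_, ?_, ?_⟩
  · rintro (i | i | i)
    · simp [Matrix.mul_fin_two, h.sq, hone, Matrix.smul_of]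
    · simp [Matrix.mul_fin_two, hone, Matrix.smul_of]
    · simp [Matrix.mul_fin_two, hone, Matrix.smul_of]
  · rintro (i | i | i) (j | j | j) hij
    · have := h.anti i j (by simpa using hij)
      simp [Matrix.mul_fin_two, this]
    all_goals first
      | (exfalso; apply hij; congr; exact Subsingleton.elim _ _)
      | simp [Matrix.mul_fin_two]
  · set S := Algebra.adjoin ℝ (Set.range (Sum.elim (fun i => !![e i, 0; 0, - e i])
      (Sum.elim (fun _ : Fin 1 => !![0, 1; 1, 0]) (fun _ : Fin 1 => !![0, 1; -1, 0]))))
    have m1 : ∀ i, !![e i, 0; 0, - e i] ∈ S := fun i => Algebra.subset_adjoin ⟨Sum.inl i, rfl⟩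
    have mX : !![0, 1; 1, 0] ∈ S := Algebra.subset_adjoin ⟨Sum.inr (Sum.inl 0), rfl⟩
    have mY : !![0, 1; -1, 0] ∈ S := Algebra.subset_adjoin ⟨Sum.inr (Sum.inr 0), rfl⟩
    have mZ : (!![1, 0; 0, -1] : Matrix (Fin 2) (Fin 2) A) ∈ S := by
      have := mul_mem mY mX
      simpa [Matrix.mul_fin_two] using this
    have m11 : (!![1, 0; 0, 0] : Matrix (Fin 2) (Fin 2) A) ∈ S := by
      have := S.smul_mem (add_mem (one_mem S) mZ) (1/2 : ℝ)
      convert this using 1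
      rw [hone]
      ext i j; fin_cases i <;> fin_cases j <;> simp [← two_smul ℝ (1 : A), smul_smul]
    have m22 : (!![0, 0; 0, 1] : Matrix (Fin 2) (Fin 2) A) ∈ S := by
      convert sub_mem (one_mem S) m11 using 1
      rw [hone]; ext i j; fin_cases i <;> fin_cases j <;> simp
    have m12 : (!![0, 1; 0, 0] : Matrix (Fin 2) (Fin 2) A) ∈ S := by
      convert mul_mem m11 mX using 1
      ext i j; fin_cases i <;> fin_cases j <;> simp
    have m21 : (!![0, 0; 1, 0] : Matrix (Fin 2) (Fin 2) A) ∈ S := by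
      convert mul_mem m22 mX using 1
      ext i j; fin_cases i <;> fin_cases j <;> simp
    have mD : ∀ a : A, !![a, 0; 0, a] ∈ S := by
      intro a
      have ha : a ∈ Algebra.adjoin ℝ (Set.range e) := by rw [h.gen]; trivial
      induction ha using Algebra.adjoin_induction with
      | mem x hx =>
        obtain ⟨i, rfl⟩ := hx
        have := mul_mem (m1 i) mZ
        simpa [Matrix.mul_fin_two] using this
      | algebraMap r =>
        convert S.algebraMap_mem r using 1
        ext i j; fin_cases i <;> fin_cases j <;> simp [Matrix.algebraMap_matrix_apply]
      | add x y _ _ hx hy =>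
        have := add_mem hx hy
        simpa using this
      | mul x y _ _ hx hy =>
        have := mul_mem hx hy
        simpa [Matrix.mul_fin_two] using this
    rw [eq_top_iff]
    rintro M -
    have := add_mem (add_mem (mul_mem m11 (mD (M 0 0))) (mul_mem m12 (mD (M 0 1))))
      (add_mem (mul_mem m21 (mD (M 1 0))) (mul_mem m22 (mD (M 1 1))))
    convert this using 1
    ext i j; fin_cases i <;> fin_cases j <;> simp [Matrix.mul_fin_two]

/-- Matrices over a product. -/
def matProdEquiv (n A B : Type) [Fintype n] [DecidableEq n] [Ring A] [Algebra ℝ A] [Ring B]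
    [Algebra ℝ B] : Matrix n n (A × B) ≃ₐ[ℝ] Matrix n n A × Matrix n n B where
  toFun M := (M.map Prod.fst, M.map Prod.snd)
  invFun P := Matrix.of fun i j => (P.1 i j, P.2 i j)
  left_inv M := by ext <;> rfl
  right_inv P := by ext <;> rfl
  map_mul' M N := by
    ext i j <;> simp [Matrix.mul_apply, Prod.fst_sum, Prod.snd_sum]
  map_add' M N := by ext <;> rfl
  commutes' r := by
    ext i j <;> by_cases hij : i = j <;> simp [Matrix.algebraMap_matrix_apply, hij]

/-- The target algebra. -/
abbrev TT (k : ℕ) : Type :=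
  Matrix (Fin (2 ^ k)) (Fin (2 ^ k)) ℍ[ℝ] × Matrix (Fin (2 ^ k)) (Fin (2 ^ k)) ℍ[ℝ]

noncomputable def matTwoEquiv (k : ℕ) : Matrix (Fin 2) (Fin 2) (Matrix (Fin (2 ^ k)) (Fin (2 ^ k)) ℍ[ℝ]) ≃ₐ[ℝ]
    Matrix (Fin (2 ^ (k + 1))) (Fin (2 ^ (k + 1))) ℍ[ℝ] :=
  (Matrix.compAlgEquiv (Fin 2) (Fin (2 ^ k)) ℍ[ℝ] ℝ).trans
    (Matrix.reindexAlgEquiv ℝ ℍ[ℝ] (finProdFinEquiv.trans (finCongr (by rw [pow_succ, mul_comm]))))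

noncomputable def ttEquiv (k : ℕ) : Matrix (Fin 2) (Fin 2) (TT k) ≃ₐ[ℝ] TT (k + 1) :=
  (matProdEquiv _ _ _).trans (AlgEquiv.prodCongr (matTwoEquiv k) (matTwoEquiv k))

/-- Clifford system of signature `(p,q)` exists on `A`. -/
def Has (p q : ℕ) (A : Type) [Ring A] [Algebra ℝ A] : Prop :=
  ∃ e : Fin p ⊕ Fin q → A, CliffSys (Sum.elim (fun _ => (1 : ℝ)) (fun _ => -1)) e

theorem Has.step {p q k : ℕ} (h : Has p q (TT k)) : Has (p + 1) (q + 1) (TT (k + 1)) := by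
  obtain ⟨e, he⟩ := h
  obtain ⟨e', he'⟩ := he.hyp
  exact ⟨_, (he'.map (ttEquiv k)).reindex
    ((Equiv.sumCongr finSumFinEquiv.symm finSumFinEquiv.symm).trans
      (Equiv.sumSumSumComm _ _ _ _).symm) (by
        rintro (i | i)
        · obtain ⟨i | i, rfl⟩ := finSumFinEquiv.surjective i <;> simp
        · obtain ⟨i | i, rfl⟩ := finSumFinEquiv.surjective i <;> simp)⟩

theorem Has.flip1 {p q : ℕ} {A : Type} [Ring A] [Algebra ℝ A] (h : Has (p + 4) q A) :
    Has p (q + 4) A := by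
  obtain ⟨e, he⟩ := h
  let f : (Fin p ⊕ Fin q) ⊕ Fin 4 ≃ Fin (p + 4) ⊕ Fin q :=
    (((Equiv.sumAssoc _ _ _).trans (Equiv.sumCongr (Equiv.refl _) (Equiv.sumComm _ _))).trans
      (Equiv.sumAssoc _ _ _).symm).trans (Equiv.sumCongr finSumFinEquiv (Equiv.refl _))
  have h1 := he.reindex f (t := Sum.elim (Sum.elim (fun _ => 1) (fun _ => -1)) (fun _ => 1)) (by
    rintro ((i | i) | i) <;> simp [f])
  obtain ⟨e', he'⟩ := h1.flip (by norm_num)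
  exact ⟨_, he'.reindex ((Equiv.sumCongr (Equiv.refl _) finSumFinEquiv.symm).trans
    (Equiv.sumAssoc _ _ _).symm) (by
      rintro (i | i)
      · simp
      · obtain ⟨i | i, rfl⟩ := finSumFinEquiv.surjective i <;> simp)⟩

theorem Has.flip2 {p q : ℕ} {A : Type} [Ring A] [Algebra ℝ A] (h : Has p (q + 4) A) :
    Has (p + 4) q A := by
  obtain ⟨e, he⟩ := h
  let f : (Fin p ⊕ Fin q) ⊕ Fin 4 ≃ Fin (p + 4) ⊕ Fin q :=
    (((Equiv.sumAssoc _ _ _).trans (Equiv.sumCongr (Equiv.refl _) (Equiv.sumComm _ _))).trans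
      (Equiv.sumAssoc _ _ _).symm).trans (Equiv.sumCongr finSumFinEquiv (Equiv.refl _))
  let g : (Fin p ⊕ Fin q) ⊕ Fin 4 ≃ Fin p ⊕ Fin (q + 4) :=
    ((Equiv.sumCongr (Equiv.refl _) finSumFinEquiv.symm).trans
    (Equiv.sumAssoc _ _ _).symm).symm
  have h1 := he.reindex g (t := Sum.elim (Sum.elim (fun _ => 1) (fun _ => -1)) (fun _ => -1)) (by
    rintro ((i | i) | i) <;> simp [g])
  obtain ⟨e', he'⟩ := h1.flip (by norm_num)
  exact ⟨_, he'.reindex f.symm (by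
      intro k
      obtain ⟨k, rfl⟩ := f.surjective k
      rw [Equiv.symm_apply_apply]
      rcases k with ((i | i) | i) <;> simp [f])⟩

theorem base_quat : ∃ e : Fin 3 → ℍ[ℝ] × ℍ[ℝ], CliffSys (fun _ => (-1 : ℝ)) e := by
  obtain ⟨I, I0, I1, I2, I3⟩ : ∃ x : ℍ[ℝ], x.re = 0 ∧ x.imI = 1 ∧ x.imJ = 0 ∧ x.imK = 0 :=
    ⟨⟨0, 1, 0, 0⟩, rfl, rfl, rfl, rfl⟩
  obtain ⟨J, J0, J1, J2, J3⟩ : ∃ x : ℍ[ℝ], x.re = 0 ∧ x.imI = 0 ∧ x.imJ = 1 ∧ x.imK = 0 :=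
    ⟨⟨0, 0, 1, 0⟩, rfl, rfl, rfl, rfl⟩
  obtain ⟨K, K0, K1, K2, K3⟩ : ∃ x : ℍ[ℝ], x.re = 0 ∧ x.imI = 0 ∧ x.imJ = 0 ∧ x.imK = 1 :=
    ⟨⟨0, 0, 0, 1⟩, rfl, rfl, rfl, rfl⟩
  refine ⟨![(I, I), (J, J), (K, -K)], ?_, ?_, ?_⟩
  · intro i
    fin_cases i <;> ext <;> simp [I0, I1, I2, I3, J0, J1, J2, J3, K0, K1, K2, K3]
  · intro i j hij
    fin_cases i <;> fin_cases j <;> first | exact absurd rfl hij | (ext <;> simp [I0, I1, I2, I3, J0, J1, J2, J3, K0, K1, K2, K3])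
  · set S := Algebra.adjoin ℝ (Set.range ![(I, I), (J, J), (K, -K)])
    have mI : (I, I) ∈ S := Algebra.subset_adjoin ⟨0, rfl⟩
    have mJ : (J, J) ∈ S := Algebra.subset_adjoin ⟨1, rfl⟩
    have mK : (K, -K) ∈ S := Algebra.subset_adjoin ⟨2, rfl⟩
    have mK' : (K, K) ∈ S := by
      convert mul_mem mI mJ using 1
      ext <;> simp [I0, I1, I2, I3, J0, J1, J2, J3, K0, K1, K2, K3]
    have mZ : ((1, -1) : ℍ[ℝ] × ℍ[ℝ]) ∈ S := by
      convert neg_mem (mul_mem mK' mK) using 1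
      ext <;> simp [K0, K1, K2, K3]
    have m1 : ((1, 0) : ℍ[ℝ] × ℍ[ℝ]) ∈ S := by
      convert S.smul_mem (add_mem (one_mem S) mZ) (1/2 : ℝ) using 1
      ext <;> simp <;> norm_num
    have m2 : ((0, 1) : ℍ[ℝ] × ℍ[ℝ]) ∈ S := by
      convert sub_mem (one_mem S) m1 using 1
      ext <;> simp
    have mD : ∀ x : ℍ[ℝ], (x, x) ∈ S := by
      intro x
      convert add_mem (add_mem (S.smul_mem (one_mem S) x.re) (S.smul_mem mI x.imI))
        (add_mem (S.smul_mem mJ x.imJ) (S.smul_mem mK' x.imK)) using 1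
      ext <;> simp [I0, I1, I2, I3, J0, J1, J2, J3, K0, K1, K2, K3]
    rw [eq_top_iff]
    rintro ⟨x, y⟩ -
    convert add_mem (mul_mem m1 (mD x)) (mul_mem m2 (mD y)) using 1
    ext <;> simp

noncomputable def oneEquiv' : ℍ[ℝ] ≃ₐ[ℝ] Matrix (Fin 1) (Fin 1) ℍ[ℝ] where
  toFun a := Matrix.of fun _ _ => a
  invFun M := M 0 0
  left_inv a := rfl
  right_inv M := by
    ext i j : 1
    rw [Subsingleton.elim i 0, Subsingleton.elim j 0]; rfl
  map_mul' a b := by ext i j : 1; simp [Matrix.mul_apply]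
  map_add' a b := rfl
  commutes' r := by
    ext i j : 1
    rw [Subsingleton.elim i 0, Subsingleton.elim j 0]
    simp [Matrix.algebraMap_matrix_apply]

noncomputable def oneEquiv : ℍ[ℝ] ≃ₐ[ℝ] Matrix (Fin (2 ^ 0)) (Fin (2 ^ 0)) ℍ[ℝ] :=
  oneEquiv'

theorem has_base : Has 0 3 (TT 0) := by
  obtain ⟨e, he⟩ := base_quat
  exact ⟨_, (he.map (AlgEquiv.prodCongr oneEquiv oneEquiv)).reindex (Equiv.emptySum (Fin 0) (Fin 3))
    (by rintro (i | i); exact i.elim0; rfl)⟩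

theorem has_all (k : ℕ) : ∀ p q : ℕ, p + q = 2 * k + 3 → (p : ℤ) - q ≡ 5 [ZMOD 8] →
    Has p q (TT k) := by
  induction k with
  | zero =>
    intro p q h1 h2
    obtain ⟨rfl, rfl⟩ : p = 0 ∧ q = 3 := by
      unfold Int.ModEq at h2; omega
    exact has_base
  | succ k ih =>
    intro p q h1 h2
    unfold Int.ModEq at h2 ih
    rcases p with _ | p
    · obtain ⟨r, rfl⟩ : ∃ r, q = r + 5 := ⟨q - 5, by omega⟩
      exact Has.flip1 (Has.step (ih 3 r (by omega) (by omega)))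
    · rcases q with _ | q
      · obtain ⟨r, rfl⟩ : ∃ r, p = r + 4 := ⟨p - 4, by omega⟩
        have := Has.step (ih r 3 (by omega) (by push_cast at *; omega))
        have := Has.flip2 (p := r + 1) (q := 0) this
        rwa [show r + 1 + 4 = r + 4 + 1 by ring] at this
      · exact Has.step (ih p q (by omega) (by push_cast at *; omega))

theorem finrank_TT (k : ℕ) : Module.finrank ℝ (TT k) = 2 ^ (2 * k + 3) := by
  rw [Module.finrank_prod, Module.finrank_matrix, Quaternion.finrank_eq_four]
  simp only [Fintype.card_fin]
  ring

/-- For `n = p + q` odd with `p − q ≡ 5 (mod 8)`, `Cl(p,q) ≅ M_{2^{(n−3)/2}}(ℍ) × M_{2^{(n−3)/2}}(ℍ)`. -/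
theorem clpq_odd_5_iso_two_matrix_quaternion (p q : ℕ) (hn : Odd (p + q))
    (h : (p : ℤ) - q ≡ 5 [ZMOD 8]) :
    Nonempty (CliffordAlgebra (Qpq p q) ≃ₐ[ℝ]
      (Matrix (Fin (2 ^ ((p + q - 3) / 2))) (Fin (2 ^ ((p + q - 3) / 2))) ℍ[ℝ] ×
        Matrix (Fin (2 ^ ((p + q - 3) / 2))) (Fin (2 ^ ((p + q - 3) / 2))) ℍ[ℝ])) := by
  have h3 : p + q = 2 * ((p + q - 3) / 2) + 3 := by
    obtain ⟨m, hm⟩ := hn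
    unfold Int.ModEq at h
    omega
  obtain ⟨e, he⟩ := has_all _ p q h3 h
  have := he.reindex finSumFinEquiv.symm
    (t := fun i : Fin (p + q) => if (i : ℕ) < p then (1 : ℝ) else -1) (by
      intro i
      obtain ⟨i | i, rfl⟩ := finSumFinEquiv.surjective i <;> simp)
  exact this.equiv ((finrank_TT _).trans (by rw [← h3]))
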